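/- Let x, y : ℝ → S³ ⊂ ℝ⁴ be C¹ closed curves (periodic with positive periods, with nowhere-vanishing derivatives) whose images are disjoint, and suppose the signed area density vanishes identically: A(s,t) = 0 for all (s,t). Then for every s₀ there exist a unit vector n ∈ ℝ⁴ and c ∈ (−1,1) such that n·y(t) = c for all t, n·x(s₀) = c, and x'(s₀) = λ(n − c·x(s₀)) for some λ ≠ 0; that is, the 2-sphere S³ ∩ {v ∈ ℝ⁴ : n·v = c} contains the image of y, passes through x(s₀), and meets the curve x orthogonally at x(s₀). -/

import Mathlib

open Matrix

lemma dotProduct_ne_one_of_ne {ι : Type*} [Fintype ι] {u v : ι → ℝ}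
    (hu : u ⬝ᵥ u = 1) (hv : v ⬝ᵥ v = 1) (huv : u ≠ v) : u ⬝ᵥ v - 1 ≠ 0 := by
  intro h
  apply huv
  rw [← sub_eq_zero, ← dotProduct_self_eq_zero]
  simp only [sub_dotProduct, dotProduct_sub, dotProduct_comm v u]
  linarith

lemma HasDerivAt.const_dotProduct {ι : Type*} [Fintype ι] {f : ℝ → ι → ℝ} {f' : ι → ℝ} {t : ℝ}
    (a : ι → ℝ) (hf : HasDerivAt f f' t) :
    HasDerivAt (fun τ => a ⬝ᵥ f τ) (a ⬝ᵥ f') t := by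
  simp only [dotProduct]
  exact HasDerivAt.fun_sum fun i _ => ((hasDerivAt_pi.1 hf) i).const_mul (a i)

lemma dotProduct_deriv_eq_zero {ι : Type*} [Fintype ι] {x : ℝ → ι → ℝ}
    (hx : Differentiable ℝ x) (hxS : ∀ s, x s ⬝ᵥ x s = 1) (s : ℝ) :
    deriv x s ⬝ᵥ x s = 0 := by
  have h : HasDerivAt (fun σ => x σ ⬝ᵥ x σ) (∑ i, (deriv x s i * x s i + x s i * deriv x s i)) s :=
    HasDerivAt.fun_sum fun i _ =>
      ((hasDerivAt_pi.1 (hx s).hasDerivAt) i).mul ((hasDerivAt_pi.1 (hx s).hasDerivAt) i)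
  simp only [hxS] at h
  have h0 := h.unique (hasDerivAt_const s (1 : ℝ))
  rw [Finset.sum_add_distrib] at h0
  simp only [dotProduct]
  simp only [mul_comm (x s _)] at h0
  linarith

/-- The signed area density is the `t`-derivative of `(a · y(t)) / (b · y(t) - 1)`, with `b` the
point and `a` the velocity of the first curve; so this quotient is constant when the density
vanishes. -/
lemma exists_dotProduct_eq_mul_of_density_eq_zero {ι : Type*} [Fintype ι] {y : ℝ → ι → ℝ}
    (hy : Differentiable ℝ y) (a b : ι → ℝ) (hb : ∀ t, b ⬝ᵥ y t - 1 ≠ 0)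
    (hA : ∀ t, ((a ⬝ᵥ deriv y t) * (b ⬝ᵥ y t - 1)
      - (a ⬝ᵥ y t) * (b ⬝ᵥ deriv y t)) / (b ⬝ᵥ y t - 1) ^ 2 = 0) :
    ∃ k : ℝ, ∀ t, a ⬝ᵥ y t = k * (b ⬝ᵥ y t - 1) := by
  have hd : ∀ t, HasDerivAt (fun τ => (a ⬝ᵥ y τ) / (b ⬝ᵥ y τ - 1)) 0 t := fun t => by
    rw [← hA t]
    exact ((hy t).hasDerivAt.const_dotProduct a).div
      (((hy t).hasDerivAt.const_dotProduct b).sub_const 1) (hb t)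
  refine ⟨(a ⬝ᵥ y 0) / (b ⬝ᵥ y 0 - 1), fun t => ?_⟩
  rw [← div_eq_iff (hb t)]
  exact is_const_of_deriv_eq_zero (fun t => (hd t).differentiableAt) (fun t => (hd t).deriv) t 0

/-- if the signed area density of a link vanishes identically, then for every
point `x(s₀)` of the first component there is a 2-sphere `S³ ∩ {n·v = c}` containing the
second component, passing through `x(s₀)`, and meeting the first component orthogonally
there. -/
theorem vanishing_density_gives_orthogonal_sphere
    (x y : ℝ → (Fin 4 → ℝ)) (L₁ L₂ : ℝ)
    (hx : ContDiff ℝ 1 x) (hy : ContDiff ℝ 1 y)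
    (hxS : ∀ s, x s ⬝ᵥ x s = 1) (hyS : ∀ t, y t ⬝ᵥ y t = 1)
    (hL₁ : 0 < L₁) (hL₂ : 0 < L₂)
    (hperx : ∀ s, x (s + L₁) = x s) (hpery : ∀ t, y (t + L₂) = y t)
    (hx' : ∀ s, deriv x s ≠ 0) (hy' : ∀ t, deriv y t ≠ 0)
    (hdisj : ∀ s t, x s ≠ y t)
    (hA : ∀ s t : ℝ,
      ((deriv x s ⬝ᵥ deriv y t) * (x s ⬝ᵥ y t - 1)
        - (deriv x s ⬝ᵥ y t) * (x s ⬝ᵥ deriv y t)) / (x s ⬝ᵥ y t - 1) ^ 2 = 0) :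
    ∀ s₀ : ℝ, ∃ (n : Fin 4 → ℝ) (c : ℝ),
      n ⬝ᵥ n = 1 ∧ -1 < c ∧ c < 1 ∧
      (∀ t, n ⬝ᵥ y t = c) ∧
      n ⬝ᵥ x s₀ = c ∧
      ∃ lam : ℝ, lam ≠ 0 ∧ deriv x s₀ = lam • (n - c • x s₀) := by
  intro s₀
  obtain ⟨k, hk⟩ := exists_dotProduct_eq_mul_of_density_eq_zero (hy.differentiable one_ne_zero)
    (deriv x s₀) (x s₀) (fun t => dotProduct_ne_one_of_ne (hxS s₀) (hyS t) (hdisj s₀ t)) (hA s₀)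
  have hort := dotProduct_deriv_eq_zero (hx.differentiable one_ne_zero) hxS s₀
  have hpos : 0 < deriv x s₀ ⬝ᵥ deriv x s₀ :=
    (Finset.sum_nonneg fun i _ => mul_self_nonneg _).lt_of_ne'
      (mt dotProduct_self_eq_zero.1 (hx' s₀))
  set v := deriv x s₀
  set r := √(v ⬝ᵥ v + k ^ 2)
  have hr2 : r ^ 2 = v ⬝ᵥ v + k ^ 2 := Real.sq_sqrt (by positivity)
  have hr : 0 < r := Real.sqrt_pos.2 (by positivity)
  obtain ⟨hk1, hk2⟩ := abs_lt.1 (abs_lt_of_sq_lt_sq (by linarith : k ^ 2 < r ^ 2) hr.le)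
  refine ⟨r⁻¹ • (v - k • x s₀), r⁻¹ * -k, ?_, ?_, ?_, fun t => ?_, ?_, r, hr.ne', ?_⟩
  · simp only [smul_dotProduct, dotProduct_smul, sub_dotProduct, dotProduct_sub, smul_eq_mul,
      dotProduct_comm (x s₀) v, hort, hxS]
    field_simp
    linarith
  · rw [inv_mul_eq_div, lt_div_iff₀ hr]
    linarith
  · rw [inv_mul_eq_div, div_lt_one hr]
    linarith
  · simp only [smul_dotProduct, sub_dotProduct, smul_eq_mul, hk t]
    ring
  · simp only [smul_dotProduct, sub_dotProduct, smul_eq_mul, hort, hxS]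
    ring
  · ext i
    simp only [Pi.smul_apply, Pi.sub_apply, smul_eq_mul]
    field_simp
    ring
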